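/- arXiv:1102.1205 — 3 statements merged into one kernel-verified Lean document; each statement's English description precedes it below -/
import Mathlib

section
/- If f : ℝ^n \ {0} → Cl_n is left monogenic (D f = 0), then the Kelvin inverse y ↦ G(y) f(y^{-1}) is left monogenic on ℝ^n \ {0}, where G(y) = (1/ω_n)(-y)/‖y‖^n and y^{-1} = -y/‖y‖². -/
open MeasureTheory
open scoped MeasureTheory
noncomputable section

/-- The surface area `ω_n` of the unit sphere `S^{n-1} ⊂ ℝⁿ`. -/
def omegaN (n : ℕ) : ℝ :=
  (μH[((n : ℝ) - 1)] (Metric.sphere (0 : EuclideanSpace ℝ (Fin n)) 1)).toReal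


lemma norm_hasFDerivAt_aux {n : ℕ} (y : EuclideanSpace ℝ (Fin n)) (hy : y ≠ 0) :
    HasFDerivAt (fun z : EuclideanSpace ℝ (Fin n) => ‖z‖) (‖y‖⁻¹ • innerSL ℝ y) y := by
  have h := (hasStrictFDerivAt_norm_sq y).hasFDerivAt.sqrt (by simpa using hy)
  have h1 : ‖y‖ ≠ 0 := by simpa using hy
  have e1 : (fun z : EuclideanSpace ℝ (Fin n) => √(‖z‖ ^ 2)) = fun z => ‖z‖ := by
    funext z; exact Real.sqrt_sq (norm_nonneg z)
  rw [e1] at h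
  rw [Real.sqrt_sq (norm_nonneg y), two_smul, smul_add, ← add_smul] at h
  have e2 : 1 / (2 * ‖y‖) + 1 / (2 * ‖y‖) = ‖y‖⁻¹ := by
    field_simp
    norm_num
  rw [e2] at h
  exact h

section alg
variable {n : ℕ} {A : Type*} [Ring A] [Algebra ℝ A] (e : Fin n → A)

lemma two_cancel_aux {a b : A} (h : (2 : ℝ) • a = (2 : ℝ) • b) : a = b := by
  have := congrArg (fun x => (2 : ℝ)⁻¹ • x) h
  simpa [smul_smul] using this

lemma anti_aux (he : ∀ i j, e i * e j + e j * e i = if i = j then (-2 : A) else 0)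
    (u : Fin n → ℝ) (j : Fin n) :
    e j * (∑ i, u i • e i) = - ((∑ i, u i • e i) * e j) - (2 * u j) • (1 : A) := by
  have : e j * (∑ i, u i • e i) + (∑ i, u i • e i) * e j = - ((2 * u j) • (1 : A)) := by
    rw [Finset.mul_sum, Finset.sum_mul, ← Finset.sum_add_distrib]
    have : ∀ i, e j * u i • e i + u i • e i * e j = if j = i then - ((2 * u i) • (1 : A)) else 0 := by
      intro i
      rw [mul_smul_comm, smul_mul_assoc, ← smul_add, he]
      split_ifs
      · rw [mul_comm, mul_smul, ← smul_neg, ofNat_smul_eq_nsmul]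
        simp
      · simp
    rw [Finset.sum_congr rfl fun i _ => this i]
    simp
  rw [eq_sub_iff_add_eq, ← sub_eq_zero]
  rw [← sub_eq_zero] at this
  rw [← this]; abel

lemma sq_aux (he : ∀ i j, e i * e j + e j * e i = if i = j then (-2 : A) else 0)
    (u : Fin n → ℝ) :
    (∑ i, u i • e i) * (∑ i, u i • e i) = (-(∑ i, u i ^ 2)) • (1 : A) := by
  set V := ∑ i, u i • e i with hV
  have h : V * V = ∑ j, u j • (e j * V) := by
    conv_lhs => rw [hV]
    rw [← hV, Finset.sum_mul]; simp
  have h2 : V * V = ∑ j, u j • (V * e j) := by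
    conv_lhs => rw [hV]
    rw [← hV, Finset.mul_sum]; simp
  have h3 : ∑ j, u j • (e j * V) = - ∑ j, u j • (V * e j) - ∑ j, (2 * u j ^ 2) • (1 : A) := by
    rw [← Finset.sum_neg_distrib, ← Finset.sum_sub_distrib]
    refine Finset.sum_congr rfl fun j _ => ?_
    rw [hV, anti_aux e he u j, smul_sub, smul_neg, smul_smul]
    congr 2; ring
  rw [← h, ← h2, ← Finset.sum_smul, ← Finset.mul_sum] at h3
  apply two_cancel_aux
  rw [two_smul]
  nth_rewrite 1 [h3]
  module

lemma sum_sq_aux (he : ∀ i j, e i * e j + e j * e i = if i = j then (-2 : A) else 0) :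
    (∑ i, e i * e i) = (-(n : ℝ)) • (1 : A) := by
  have h : ∀ i, e i * e i = (-1 : ℝ) • (1 : A) := by
    intro i
    apply two_cancel_aux
    have := he i i
    rw [if_pos rfl] at this
    rw [two_smul, this, ofNat_smul_eq_nsmul]
    simp
  simp [h, Finset.sum_const, Nat.cast_smul_eq_nsmul]
end alg

/-- Kelvin inversion: in an algebra `A` with Clifford generators for `ℝⁿ`, if
`f : ℝⁿ \ {0} → A` is left monogenic (`Df = 0`), then `y ↦ G(y) f(y⁻¹)` is left monogenic
on `ℝⁿ \ {0}`, where `G(y) = (1/ω_n)(-y)/‖y‖ⁿ` and `y⁻¹ = -y/‖y‖²`. -/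
theorem stmt9 (n : ℕ) (hn : 2 ≤ n) {A : Type*} [NormedRing A] [NormedAlgebra ℝ A]
    (e : Fin n → A)
    (he : ∀ i j, e i * e j + e j * e i = if i = j then (-2 : A) else 0)
    (G : EuclideanSpace ℝ (Fin n) → A)
    (hG : ∀ u, G u = (omegaN n)⁻¹ • (‖u‖ ^ n)⁻¹ • (∑ i : Fin n, (-(u i)) • e i))
    (f : EuclideanSpace ℝ (Fin n) → A)
    (hf : ∀ y : EuclideanSpace ℝ (Fin n), y ≠ 0 → ContDiffAt ℝ 1 f y)
    (hmono : ∀ y : EuclideanSpace ℝ (Fin n), y ≠ 0 →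
      ∑ j : Fin n, e j * fderiv ℝ f y (EuclideanSpace.single j 1) = 0)
    (y : EuclideanSpace ℝ (Fin n)) (hy : y ≠ 0) :
    ∑ j : Fin n, e j *
        fderiv ℝ (fun z => G z * f ((-(‖z‖ ^ 2)⁻¹) • z)) y (EuclideanSpace.single j 1) = 0 := by
  have hr : ‖y‖ ≠ 0 := by simpa using hy
  set r := ‖y‖ with hrdef
  set V : EuclideanSpace ℝ (Fin n) →L[ℝ] A :=
    ∑ i : Fin n, (EuclideanSpace.proj i : EuclideanSpace ℝ (Fin n) →L[ℝ] ℝ).smulRight (e i) with hVdef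
  have hVa : ∀ u, V u = ∑ i, u i • e i := by intro u; simp [hVdef]
  have hVs : ∀ j, V (EuclideanSpace.single j 1) = e j := by
    intro j; rw [hVa]; simp [PiLp.single_apply]
  have hG' : G = fun u => (omegaN n)⁻¹ • (‖u‖ ^ n)⁻¹ • (-(V u)) := by
    funext u; rw [hG, hVa]; simp
  set c := (omegaN n)⁻¹
  have hN := norm_hasFDerivAt_aux y hy
  obtain ⟨m, rfl⟩ : ∃ m, n = m + 1 := ⟨n - 1, by omega⟩
  have hP := (hasDerivAt_inv (pow_ne_zero (m + 1) hr)).comp_hasFDerivAt y (hN.pow (m + 1))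
  have hQ := (hasDerivAt_inv (pow_ne_zero 2 hr)).comp_hasFDerivAt y (hN.pow 2)
  have hGd := (hP.smul V.hasFDerivAt.neg).const_smul c
  have hφ := hQ.neg.smul (hasFDerivAt_id (𝕜 := ℝ) y)
  set w := (-(r ^ 2)⁻¹) • y with hw
  have hw0 : w ≠ 0 := smul_ne_zero (by simpa using hr) hy
  have hfd : HasFDerivAt f (fderiv ℝ f w) w := ((hf w hw0).differentiableAt (by simp)).hasFDerivAt
  have hmw := hmono w hw0
  set L := fderiv ℝ f w
  have hfφ := HasFDerivAt.comp (g := f) (g' := L) y hfd hφ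
  have hH := hGd.mul' hfφ
  have key : ∀ v, fderiv ℝ (fun z => G z * f ((-(‖z‖ ^ 2)⁻¹) • z)) y v
      = ((c * ((m + 1 : ℝ) * (r ^ (m + 3))⁻¹ * inner ℝ y v)) • V y - (c * (r ^ (m + 1))⁻¹) • V v) * f w
        + ((-c * (r ^ (m + 1))⁻¹) • V y) *
          ((-(r ^ 2)⁻¹) • L v + (2 * (r ^ 4)⁻¹ * inner ℝ y v) • L y) := by
    intro v
    rw [hG']
    have h5 : fderiv ℝ (fun z => (c • (‖z‖ ^ (m + 1))⁻¹ • (-(V z))) * f ((-(‖z‖ ^ 2)⁻¹) • z)) y = _ :=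
      hH.fderiv
    rw [h5]
    have hw2 : ((-(fun y : ℝ => y⁻¹) ∘ fun x : EuclideanSpace ℝ (Fin (m + 1)) => ‖x‖ ^ 2) • id) y = w := rfl
    simp only [_root_.add_apply, _root_.smul_apply,
      ContinuousLinearMap.comp_apply, ContinuousLinearMap.smulRight_apply, _root_.neg_apply,
      Function.comp_apply, hw2, Pi.smul_apply, Pi.neg_apply, Pi.smul_apply', id,
      ContinuousLinearMap.id_apply, innerSL_apply_apply, map_add, map_smul, smul_eq_mul, MulOpposite.smul_eq_mul_unop,
      MulOpposite.unop_op, ← hrdef]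
    rw [add_comm]
    congr 1
    · congr 1
      have : c * ((m + 1 : ℝ) * (r ^ (m + 3))⁻¹ * inner ℝ y v)
        = - (c * (-((r ^ (m + 1)) ^ 2)⁻¹ * ((m + 1) • r ^ (m + 1 - 1) * (r⁻¹ * inner ℝ y v)))) := by
        simp only [nsmul_eq_mul, Nat.add_sub_cancel]
        push_cast
        field_simp
        ring
      rw [this]
      module
    · congr 1
      · module
      · congr 2
        simp only [nsmul_eq_mul]
        push_cast
        field_simp
  simp only [key]
  have hin : ∀ j, inner ℝ y (EuclideanSpace.single j (1 : ℝ)) = y j := by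
    intro j; simp [EuclideanSpace.inner_single_right]
  simp only [hin, hVs]
  have hsq : V y * V y = (-(r ^ 2)) • (1 : A) := by
    rw [hVa, sq_aux e he, hrdef, EuclideanSpace.real_norm_sq_eq]
  have h1 : ∑ j, y j • (e j * V y) = (-(r ^ 2)) • (1 : A) := by
    rw [← hsq]; nth_rewrite 2 [hVa]; simp [Finset.sum_mul]
  have h2 := sum_sq_aux e he
  have hLy : L y = ∑ j, y j • L (EuclideanSpace.single j 1) := by
    have : y = ∑ j, y j • EuclideanSpace.single j (1 : ℝ) := by
      ext i; simp [Pi.single_apply]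
    conv_lhs => rw [this]
    simp
  have h3 : ∑ j, e j * V y * L (EuclideanSpace.single j 1) = (-2 : ℝ) • L y := by
    have : ∀ j, e j * V y * L (EuclideanSpace.single j 1)
        = - (V y * (e j * L (EuclideanSpace.single j 1)))
          + (-2 : ℝ) • (y j • L (EuclideanSpace.single j 1)) := by
      intro j
      rw [hVa, anti_aux e he y j, sub_mul, neg_mul, mul_assoc, smul_mul_assoc, one_mul]
      module
    simp only [this]
    rw [Finset.sum_add_distrib, Finset.sum_neg_distrib, ← Finset.mul_sum, hmw, ← Finset.smul_sum,
      ← hLy]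
    simp
  have h4 : ∀ j, e j * (((c * ((m + 1 : ℝ) * (r ^ (m + 3))⁻¹ * y j)) • V y
        - (c * (r ^ (m + 1))⁻¹) • e j) * f w
        + ((-c * (r ^ (m + 1))⁻¹) • V y) *
          ((-(r ^ 2)⁻¹) • L (EuclideanSpace.single j 1) + (2 * (r ^ 4)⁻¹ * y j) • L y))
      = (c * ((m + 1 : ℝ) * (r ^ (m + 3))⁻¹)) • ((y j • (e j * V y)) * f w)
        - (c * (r ^ (m + 1))⁻¹) • ((e j * e j) * f w)
        + (c * (r ^ (m + 1))⁻¹ * (r ^ 2)⁻¹) • (e j * V y * L (EuclideanSpace.single j 1))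
        - (c * (r ^ (m + 1))⁻¹ * 2 * (r ^ 4)⁻¹) • ((y j • (e j * V y)) * L y) := by
    intro j
    simp only [mul_add, sub_mul, mul_sub, smul_mul_assoc, mul_smul_comm, smul_smul, mul_assoc]
    module
  simp only [h4]
  rw [Finset.sum_sub_distrib, Finset.sum_add_distrib, Finset.sum_sub_distrib]
  simp only [← Finset.smul_sum, ← Finset.sum_mul]
  rw [h1, h2, h3]
  simp only [smul_mul_assoc, one_mul, smul_smul]
  rw [← sub_smul, add_sub_assoc, ← sub_smul]
  have z1 : c * ((m + 1 : ℝ) * (r ^ (m + 3))⁻¹) * -r ^ 2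
      - c * (r ^ (m + 1))⁻¹ * -((m + 1 : ℕ) : ℝ) = 0 := by
    push_cast; field_simp; ring
  have z2 : c * (r ^ (m + 1))⁻¹ * (r ^ 2)⁻¹ * -2 - c * (r ^ (m + 1))⁻¹ * 2 * (r ^ 4)⁻¹ * -r ^ 2 = 0 := by
    field_simp; ring
  rw [z1, z2]; simp
end
end

section
/- Mean value of reflected harmonics: let n > 2 and let h_k : ℝ^n → ℝ be a harmonic polynomial homogeneous of degree k. Then for every u ∈ S^{n-1}, (1/ω_n) ∫_{S^{n-1}} h_k(u - 2⟨x,u⟩x) dS(x) = ((n-2)/(n-2+2k)) h_k(u), where ω_n is the surface area of S^{n-1}. -/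
open MeasureTheory
open scoped MeasureTheory RealInnerProductSpace
noncomputable section

lemma sphere_nonempty_pos (m : ℕ) :
    μH[(m : ℝ)] (Metric.sphere (0 : EuclideanSpace ℝ (Fin (m+1))) 1) ≠ 0 := by
  intro h0
  let p : EuclideanSpace ℝ (Fin (m+1)) → (Fin m → ℝ) := fun x i => x i.succ
  have hp : LipschitzWith 1 p := by
    apply LipschitzWith.of_dist_le_mul
    intro x y
    rw [NNReal.coe_one, one_mul, dist_pi_le_iff dist_nonneg]
    intro i
    rw [dist_eq_norm, dist_eq_norm]
    exact PiLp.norm_apply_le (x - y) i.succ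
  have h1 := hp.hausdorffMeasure_image_le (d := (m:ℝ)) (by positivity)
    (Metric.sphere (0 : EuclideanSpace ℝ (Fin (m+1))) 1)
  rw [h0, mul_zero] at h1
  have h2 : (μH[(m:ℝ)] : Measure (Fin m → ℝ)) = volume := by
    have := hausdorffMeasure_pi_real (ι := Fin m)
    simpa using this
  rw [h2] at h1
  let U : Set (Fin m → ℝ) := {w | ∑ i, (w i)^2 < 1}
  have hU : IsOpen U := isOpen_lt (by fun_prop) continuous_const
  have hUn : U.Nonempty := ⟨0, by simp [U]⟩
  have hsub : U ⊆ p '' (Metric.sphere (0 : EuclideanSpace ℝ (Fin (m+1))) 1) := by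
    intro w hw
    have hw' : ∑ i, (w i)^2 < 1 := hw
    refine ⟨WithLp.toLp 2 (Fin.cons (Real.sqrt (1 - ∑ i, (w i)^2)) w), ?_, ?_⟩
    · rw [mem_sphere_zero_iff_norm, EuclideanSpace.norm_eq, Fin.sum_univ_succ]
      simp [Real.sq_sqrt (sub_nonneg.2 hw'.le)]
    · ext i; simp [p]
  have := hU.measure_pos volume hUn
  exact absurd (le_trans (measure_mono hsub) h1) (not_le.2 this)

lemma sphere_finite (m : ℕ) :
    μH[(m : ℝ)] (Metric.sphere (0 : EuclideanSpace ℝ (Fin (m+1))) 1) ≠ ⊤ := by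
  let q : Fin (m+1) → ℝ → (Fin m → ℝ) → EuclideanSpace ℝ (Fin (m+1)) := 
    fun j σ w => WithLp.toLp 2 (j.insertNth σ w)
  let φ : Fin (m+1) → ℝ → (Fin m → ℝ) → EuclideanSpace ℝ (Fin (m+1)) := 
    fun j σ w => ‖q j σ w‖⁻¹ • q j σ w
  let K : Set (Fin m → ℝ) := Metric.closedBall 0 1
  have hq : ∀ j σ, ContDiff ℝ 1 (q j σ) := by
    intro j σ
    rw [contDiff_euclidean]
    intro i
    refine Fin.succAboveCases j ?_ ?_ i
    · simp [q]; exact contDiff_const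
    · intro l; simp [q]; exact contDiff_apply ℝ ℝ l
  have hq0 : ∀ j σ w, σ ≠ 0 → q j σ w ≠ 0 := by
    intro j σ w hσ h
    apply hσ
    have := congrArg (fun v : EuclideanSpace ℝ (Fin (m+1)) => v j) h
    simpa [q] using this
  have hφ : ∀ j σ, σ ≠ 0 → ContDiff ℝ 1 (φ j σ) := by
    intro j σ hσ
    exact (((hq j σ).norm ℝ (fun w => hq0 j σ w hσ)).inv
      (fun w => norm_ne_zero_iff.2 (hq0 j σ w hσ))).smul (hq j σ)
  have h2 : (μH[(m:ℝ)] : Measure (Fin m → ℝ)) = volume := by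
    have := hausdorffMeasure_pi_real (ι := Fin m)
    simpa using this
  have hfin : ∀ j σ, σ ≠ 0 → μH[(m:ℝ)] (φ j σ '' K) < ⊤ := by
    intro j σ hσ
    obtain ⟨C, hC⟩ := (hφ j σ hσ).contDiffOn (s := K) |>.exists_lipschitzOnWith (by norm_num)
      (convex_closedBall _ _) (isCompact_closedBall _ _)
    refine (hC.hausdorffMeasure_image_le (d := (m:ℝ)) (by positivity)).trans_lt ?_
    rw [h2]
    exact ENNReal.mul_lt_top (by simp) (isCompact_closedBall _ _).measure_lt_top
  have hsub : Metric.sphere (0 : EuclideanSpace ℝ (Fin (m+1))) 1 ⊆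
      ⋃ j : Fin (m+1), (φ j 1 '' K ∪ φ j (-1) '' K) := by
    intro x hx
    rw [mem_sphere_zero_iff_norm] at hx
    obtain ⟨j, hj⟩ := Finite.exists_max (fun i => |x i|)
    have hxj : x j ≠ 0 := by
      intro h0
      have : x = 0 := by
        ext i
        have := hj i
        simp only [h0, abs_zero] at this
        simpa using this
      simp [this] at hx
    have hpos : 0 < |x j| := abs_pos.2 hxj
    let w : Fin m → ℝ := fun l => x (j.succAbove l) / |x j|
    have hwK : w ∈ K := by
      rw [mem_closedBall_zero_iff, pi_norm_le_iff_of_nonneg zero_le_one]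
      intro l
      simp only [w, Real.norm_eq_abs, abs_div, abs_abs]
      exact (div_le_one hpos).2 (hj _)
    have hqx : q j (x j / |x j|) w = |x j|⁻¹ • x := by
      ext i
      refine Fin.succAboveCases j ?_ ?_ i
      · simp [q, div_eq_inv_mul]
      · intro l; simp [q, w, div_eq_inv_mul]
    have hφx : φ j (x j / |x j|) w = x := by
      simp only [φ, hqx, norm_smul, hx, smul_smul]
      simp [hpos.ne']
    rw [Set.mem_iUnion]
    refine ⟨j, ?_⟩
    rcases lt_or_gt_of_ne hxj with h | h
    · right
      refine ⟨w, hwK, ?_⟩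
      rwa [abs_of_neg h, div_neg, div_self hxj] at hφx
    · left
      refine ⟨w, hwK, ?_⟩
      rwa [abs_of_pos h, div_self hxj] at hφx
  refine ((measure_mono hsub).trans_lt ?_).ne
  refine (measure_iUnion_fintype_le _ _).trans_lt (ENNReal.sum_lt_top.2 fun j _ => ?_)
  exact (measure_union_le _ _).trans_lt
    (ENNReal.add_lt_top.2 ⟨hfin j 1 one_ne_zero, hfin j (-1) (by norm_num)⟩)

lemma integrable_sphere {n : ℕ} {d : ℝ}
    (hfin : μH[d] (Metric.sphere (0 : EuclideanSpace ℝ (Fin n)) 1) ≠ ⊤)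
    {f : EuclideanSpace ℝ (Fin n) → ℝ} (hf : Continuous f) :
    Integrable f (μH[d].restrict (Metric.sphere (0 : EuclideanSpace ℝ (Fin n)) 1)) :=
  hf.continuousOn.integrableOn_of_subset_isCompact (isCompact_sphere _ _)
    Metric.isClosed_sphere.measurableSet subset_rfl hfin

/-- Rotation by angle `t` in the plane of the coordinates `a`, `b`. -/
def rotAB {n : ℕ} (a b : Fin n) (t : ℝ) (x : EuclideanSpace ℝ (Fin n)) :
    EuclideanSpace ℝ (Fin n) :=
  x + ((Real.cos t - 1) * x a - Real.sin t * x b) • EuclideanSpace.single a (1:ℝ)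
    + ((Real.cos t - 1) * x b + Real.sin t * x a) • EuclideanSpace.single b (1:ℝ)

lemma rotAB_norm {n : ℕ} {a b : Fin n} (hab : a ≠ b) (t : ℝ) (x : EuclideanSpace ℝ (Fin n)) :
    ‖rotAB a b t x‖ = ‖x‖ := by
  rw [← sq_eq_sq₀ (norm_nonneg _) (norm_nonneg _)]
  unfold rotAB
  set A := (Real.cos t - 1) * x a - Real.sin t * x b with hA
  set B := (Real.cos t - 1) * x b + Real.sin t * x a with hB
  rw [norm_add_sq_real, norm_add_sq_real]
  simp only [inner_add_left, inner_smul_left, inner_smul_right, norm_smul,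
    EuclideanSpace.inner_single_right, EuclideanSpace.norm_single]
  simp [hab, hab.symm, mul_pow]
  have := Real.sin_sq_add_cos_sq t
  rw [hA, hB]
  linear_combination ((x a)^2 + (x b)^2) * this

/-- The rotation as a linear isometry equivalence. -/
def rotIso {n : ℕ} {a b : Fin n} (hab : a ≠ b) (t : ℝ) :
    EuclideanSpace ℝ (Fin n) ≃ₗᵢ[ℝ] EuclideanSpace ℝ (Fin n) :=
  LinearIsometry.toLinearIsometryEquiv
    { toFun := rotAB a b t
      map_add' := by intro x y; unfold rotAB; simp only [PiLp.add_apply]; module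
      map_smul' := by
        intro c x; unfold rotAB; simp only [PiLp.smul_apply, smul_eq_mul, RingHom.id_apply]; module
      norm_map' := rotAB_norm hab t } rfl

lemma integral_rot {n : ℕ} (d : ℝ) {a b : Fin n} (hab : a ≠ b) (t : ℝ)
    (f : EuclideanSpace ℝ (Fin n) → ℝ) :
    ∫ x in Metric.sphere (0 : EuclideanSpace ℝ (Fin n)) 1, f (rotAB a b t x) ∂μH[d] =
      ∫ x in Metric.sphere (0 : EuclideanSpace ℝ (Fin n)) 1, f x ∂μH[d] := by
  have h1 := (rotIso hab t).toIsometryEquiv.measurePreserving_hausdorffMeasure d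
  have h2 := h1.setIntegral_preimage_emb
    (rotIso hab t).toIsometryEquiv.toHomeomorph.measurableEmbedding f
    (Metric.sphere (0 : EuclideanSpace ℝ (Fin n)) 1)
  rw [← h2]
  have : (rotIso hab t).toIsometryEquiv ⁻¹' Metric.sphere (0 : EuclideanSpace ℝ (Fin n)) 1
      = Metric.sphere (0 : EuclideanSpace ℝ (Fin n)) 1 := by
    ext x
    simp
  rw [this]
  rfl

/-- Velocity of the rotation. -/
def rotVel {n : ℕ} (a b : Fin n) (t : ℝ) (x : EuclideanSpace ℝ (Fin n)) :
    EuclideanSpace ℝ (Fin n) :=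
  ((-Real.sin t) * x a - Real.cos t * x b) • EuclideanSpace.single a (1:ℝ)
    + ((-Real.sin t) * x b + Real.cos t * x a) • EuclideanSpace.single b (1:ℝ)

lemma rotAB_hasDerivAt {n : ℕ} (a b : Fin n) (t : ℝ) (x : EuclideanSpace ℝ (Fin n)) :
    HasDerivAt (fun t => rotAB a b t x) (rotVel a b t x) t := by
  unfold rotAB rotVel
  have h1 : HasDerivAt (fun t => (Real.cos t - 1) * x a - Real.sin t * x b)
      ((-Real.sin t) * x a - Real.cos t * x b) t :=
    (((Real.hasDerivAt_cos t).sub_const 1).mul_const _).sub ((Real.hasDerivAt_sin t).mul_const _)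
  have h2 : HasDerivAt (fun t => (Real.cos t - 1) * x b + Real.sin t * x a)
      ((-Real.sin t) * x b + Real.cos t * x a) t :=
    (((Real.hasDerivAt_cos t).sub_const 1).mul_const _).add ((Real.hasDerivAt_sin t).mul_const _)
  exact ((h1.smul_const _).const_add x).add (h2.smul_const _)

lemma integral_killing {n : ℕ} {d : ℝ}
    (hfin : μH[d] (Metric.sphere (0 : EuclideanSpace ℝ (Fin n)) 1) ≠ ⊤)
    {f : EuclideanSpace ℝ (Fin n) → ℝ} (hf : ContDiff ℝ 1 f) (a b : Fin n) :
    ∫ x in Metric.sphere (0 : EuclideanSpace ℝ (Fin n)) 1,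
      (x a * fderiv ℝ f x (EuclideanSpace.single b 1)
        - x b * fderiv ℝ f x (EuclideanSpace.single a 1)) ∂μH[d] = 0 := by
  by_cases hab : a = b
  · subst hab; simp
  have hcr : Continuous (fun p : ℝ × EuclideanSpace ℝ (Fin n) => rotAB a b p.1 p.2) := by
    unfold rotAB; fun_prop
  have hcv : Continuous (fun p : ℝ × EuclideanSpace ℝ (Fin n) => rotVel a b p.1 p.2) := by
    unfold rotVel; fun_prop
  have hfd : Continuous (fderiv ℝ f) := hf.continuous_fderiv (by norm_num)
  let F' : ℝ → EuclideanSpace ℝ (Fin n) → ℝ :=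
    fun t x => fderiv ℝ f (rotAB a b t x) (rotVel a b t x)
  have hF' : Continuous (fun p : ℝ × EuclideanSpace ℝ (Fin n) => F' p.1 p.2) :=
    (hfd.comp hcr).clm_apply hcv
  obtain ⟨C, hC⟩ := ((isCompact_Icc (a := (-1:ℝ)) (b := 1)).prod
    (isCompact_sphere (0 : EuclideanSpace ℝ (Fin n)) 1)).exists_bound_of_continuousOn
      hF'.continuousOn
  have key := hasDerivAt_integral_of_dominated_loc_of_deriv_le
    (μ := μH[d].restrict (Metric.sphere (0 : EuclideanSpace ℝ (Fin n)) 1))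
    (F := fun t x => f (rotAB a b t x)) (F' := F') (x₀ := (0:ℝ)) (s := Set.Icc (-1) 1)
    (bound := fun _ => C) (Icc_mem_nhds (by norm_num) (by norm_num))
    (Filter.Eventually.of_forall fun t => (integrable_sphere hfin
      (hf.continuous.comp (hcr.comp (by fun_prop : Continuous fun x => (t, x))))).aestronglyMeasurable)
    (integrable_sphere hfin
      (hf.continuous.comp (hcr.comp (by fun_prop : Continuous fun x => ((0:ℝ), x)))))
    (integrable_sphere hfin
      (hF'.comp (by fun_prop : Continuous fun x => ((0:ℝ), x)))).aestronglyMeasurable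
    (by
      refine (ae_restrict_iff' Metric.isClosed_sphere.measurableSet).2
        (Filter.Eventually.of_forall fun x hx t ht => hC (t, x) ⟨ht, hx⟩))
    (integrable_sphere hfin continuous_const)
    (Filter.Eventually.of_forall fun x t _ =>
      ((hf.differentiable (by norm_num)) _).hasFDerivAt.comp_hasDerivAt t
        (rotAB_hasDerivAt a b t x))
  have h2 := key.2
  simp only [integral_rot d hab] at h2
  have h3 := h2.unique (hasDerivAt_const _ _)
  rw [← h3]
  refine integral_congr_ae (Filter.Eventually.of_forall fun x => ?_)
  simp only [F', rotAB, rotVel]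
  simp
  ring

lemma integral_div {n : ℕ} {d : ℝ}
    (hfin : μH[d] (Metric.sphere (0 : EuclideanSpace ℝ (Fin n)) 1) ≠ ⊤)
    {g : Fin n → EuclideanSpace ℝ (Fin n) → ℝ} (hg : ∀ b, ContDiff ℝ 1 (g b)) :
    ∫ x in Metric.sphere (0 : EuclideanSpace ℝ (Fin n)) 1,
      (∑ b, fderiv ℝ (g b) x (EuclideanSpace.single b 1) - ∑ b, x b * fderiv ℝ (g b) x x
        - ((n:ℝ) - 1) * ∑ b, x b * g b x) ∂μH[d] = 0 := by
  have hx : ∀ a : Fin n, ContDiff ℝ 1 (fun x : EuclideanSpace ℝ (Fin n) => x a) := 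
    fun a => (EuclideanSpace.proj (𝕜 := ℝ) a : EuclideanSpace ℝ (Fin n) →L[ℝ] ℝ).contDiff
  have hf : ∀ a b, ContDiff ℝ 1 (fun x : EuclideanSpace ℝ (Fin n) => x a * g b x) := 
    fun a b => (hx a).mul (hg b)
  have hfd : ∀ a b x v, fderiv ℝ (fun x : EuclideanSpace ℝ (Fin n) => x a * g b x) x v
      = x a * fderiv ℝ (g b) x v + v a * g b x := by
    intro a b x v
    have h1 : HasFDerivAt (fun x : EuclideanSpace ℝ (Fin n) => x a)
      (EuclideanSpace.proj (𝕜 := ℝ) a : EuclideanSpace ℝ (Fin n) →L[ℝ] ℝ) x :=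
      (EuclideanSpace.proj (𝕜 := ℝ) a : EuclideanSpace ℝ (Fin n) →L[ℝ] ℝ).hasFDerivAt
    have h2 := (h1.mul ((hg b).differentiable (by norm_num) x).hasFDerivAt).fderiv
    rw [show (fun x : EuclideanSpace ℝ (Fin n) => x a * g b x)
      = (fun x : EuclideanSpace ℝ (Fin n) => x a) * g b from rfl, h2]
    simp
    ring
  have hsum : ∫ x in Metric.sphere (0 : EuclideanSpace ℝ (Fin n)) 1,
      (∑ b, ∑ a, (x a * fderiv ℝ (fun x : EuclideanSpace ℝ (Fin n) => x a * g b x) x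
          (EuclideanSpace.single b 1)
        - x b * fderiv ℝ (fun x : EuclideanSpace ℝ (Fin n) => x a * g b x) x
          (EuclideanSpace.single a 1))) ∂μH[d] = 0 := by
    have hi : ∀ a b, Integrable (fun x : EuclideanSpace ℝ (Fin n) =>
        (x a * fderiv ℝ (fun x : EuclideanSpace ℝ (Fin n) => x a * g b x) x
          (EuclideanSpace.single b 1)
        - x b * fderiv ℝ (fun x : EuclideanSpace ℝ (Fin n) => x a * g b x) x
          (EuclideanSpace.single a 1)))
        (μH[d].restrict (Metric.sphere (0 : EuclideanSpace ℝ (Fin n)) 1)) := by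
      intro a b
      apply integrable_sphere hfin
      have := (hf a b).continuous_fderiv (by norm_num)
      fun_prop
    rw [integral_finsetSum _ (fun b _ => integrable_finsetSum _ (fun a _ => hi a b))]
    refine Finset.sum_eq_zero fun b _ => ?_
    rw [integral_finsetSum _ (fun a _ => hi a b)]
    exact Finset.sum_eq_zero fun a _ => integral_killing hfin (hf a b) a b
  rw [← hsum]
  refine setIntegral_congr_fun Metric.isClosed_sphere.measurableSet fun x hx => ?_
  simp only [hfd]
  have hn : ∑ a, x a * x a = 1 := by
    rw [mem_sphere_zero_iff_norm] at hx
    have := EuclideanSpace.real_norm_sq_eq x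
    rw [hx] at this
    simpa [sq] using this.symm
  have hxs : ∀ L : EuclideanSpace ℝ (Fin n) →L[ℝ] ℝ, 
      L x = ∑ a, x a * L (EuclideanSpace.single a 1) := by
    intro L
    have := (EuclideanSpace.basisFun (Fin n) ℝ).sum_repr x
    conv_lhs => rw [← this]
    simp
  rw [Finset.mul_sum, ← Finset.sum_sub_distrib, ← Finset.sum_sub_distrib]
  refine Finset.sum_congr rfl fun b _ => ?_
  rw [hxs (fderiv ℝ (g b) x)]
  have e : ∀ a, x a * (x a * (fderiv ℝ (g b) x) (EuclideanSpace.single b 1) 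
        + (EuclideanSpace.single b (1:ℝ)) a * g b x) -
      x b * (x a * (fderiv ℝ (g b) x) (EuclideanSpace.single a 1) 
        + (EuclideanSpace.single a (1:ℝ)) a * g b x)
      = (x a * x a) * (fderiv ℝ (g b) x) (EuclideanSpace.single b 1)
        + (if a = b then x a * g b x else 0) 
        - x b * (x a * (fderiv ℝ (g b) x) (EuclideanSpace.single a 1))
        - x b * g b x := by
    intro a
    by_cases h : a = b
    · simp [h]; ring
    · simp [h]; ring
  simp only [e, Finset.sum_sub_distrib, Finset.sum_add_distrib, ← Finset.sum_mul, hn, 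
    ← Finset.mul_sum]
  simp
  ring

section Harm
variable {n : ℕ}

lemma fd_apply {h : EuclideanSpace ℝ (Fin n) → ℝ} (hsm : ContDiff ℝ (⊤ : ℕ∞) h)
    (v w x : EuclideanSpace ℝ (Fin n)) :
    fderiv ℝ (fun y => fderiv ℝ h y v) x w = fderiv ℝ (fderiv ℝ h) x w v := by
  have h1 : DifferentiableAt ℝ (fderiv ℝ h) x :=
    (hsm.fderiv_right (m := 1) (by rw [show (1:WithTop ℕ∞) + 1 = ((2:ℕ∞) : WithTop ℕ∞) from rfl]; exact WithTop.coe_le_coe.2 le_top)).differentiable (by norm_num) x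
  rw [fderiv_clm_apply h1 (by fun_prop)]
  simp

lemma fd_symm {h : EuclideanSpace ℝ (Fin n) → ℝ} (hsm : ContDiff ℝ (⊤ : ℕ∞) h)
    (v w x : EuclideanSpace ℝ (Fin n)) :
    fderiv ℝ (fderiv ℝ h) x w v = fderiv ℝ (fderiv ℝ h) x v w := by
  have := hsm.contDiffAt (x := x) |>.isSymmSndFDerivAt
    (by rw [minSmoothness_of_isRCLikeNormedField, show (2:WithTop ℕ∞) = ((2:ℕ∞) : WithTop ℕ∞) from rfl]; exact WithTop.coe_le_coe.2 le_top)
  exact this.eq w v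

lemma fd_swap {h : EuclideanSpace ℝ (Fin n) → ℝ} (hsm : ContDiff ℝ (⊤ : ℕ∞) h)
    (v w x : EuclideanSpace ℝ (Fin n)) :
    fderiv ℝ (fun y => fderiv ℝ h y v) x w = fderiv ℝ (fun y => fderiv ℝ h y w) x v := by
  rw [fd_apply hsm, fd_apply hsm, fd_symm hsm]

lemma fd_smooth {h : EuclideanSpace ℝ (Fin n) → ℝ} (hsm : ContDiff ℝ (⊤ : ℕ∞) h)
    (v : EuclideanSpace ℝ (Fin n)) : ContDiff ℝ (⊤ : ℕ∞) (fun y => fderiv ℝ h y v) :=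
  (hsm.fderiv_right (m := (⊤ : ℕ∞)) (by exact_mod_cast le_top)).clm_apply contDiff_const

lemma fd_harm {h : EuclideanSpace ℝ (Fin n) → ℝ} (hsm : ContDiff ℝ (⊤ : ℕ∞) h)
    (hharm : ∀ x, ∑ j : Fin n,
      fderiv ℝ (fun y => fderiv ℝ h y (EuclideanSpace.single j 1)) x
        (EuclideanSpace.single j 1) = 0) (u : EuclideanSpace ℝ (Fin n)) :
    ∀ x, ∑ j : Fin n,
      fderiv ℝ (fun y => fderiv ℝ (fun z => fderiv ℝ h z u) y (EuclideanSpace.single j 1)) x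
        (EuclideanSpace.single j 1) = 0 := by
  intro x
  have e : ∀ j : Fin n, fderiv ℝ (fun y => fderiv ℝ (fun z => fderiv ℝ h z u) y
      (EuclideanSpace.single j 1)) x (EuclideanSpace.single j 1) =
      fderiv ℝ (fun y => fderiv ℝ (fun z => fderiv ℝ h z (EuclideanSpace.single j 1)) y
        (EuclideanSpace.single j 1)) x u := by
    intro j
    rw [show (fun y => fderiv ℝ (fun z => fderiv ℝ h z u) y (EuclideanSpace.single j 1)) =
      (fun y => fderiv ℝ (fun z => fderiv ℝ h z (EuclideanSpace.single j 1)) y u) from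
      funext fun y => fd_swap hsm _ _ _]
    exact fd_swap (fd_smooth hsm _) _ _ _
  simp only [e]
  have h0 : fderiv ℝ (fun y => ∑ j : Fin n, fderiv ℝ (fun z => fderiv ℝ h z
      (EuclideanSpace.single j 1)) y (EuclideanSpace.single j 1)) x u = 0 := by
    simp only [hharm]; simp
  rw [fderiv_fun_sum (fun j _ =>
    (fd_smooth (fd_smooth hsm _) _).differentiable (by simp) x)] at h0
  simpa using h0

lemma fd_hom {k : ℕ} {h : EuclideanSpace ℝ (Fin n) → ℝ} (hsm : ContDiff ℝ (⊤ : ℕ∞) h)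
    (hhom : ∀ (c : ℝ) x, h (c • x) = c ^ (k+1) * h x) (u : EuclideanSpace ℝ (Fin n)) :
    ∀ (c : ℝ) x, fderiv ℝ h (c • x) u = c ^ k * fderiv ℝ h x u := by
  intro c x
  have hd : Differentiable ℝ h := hsm.differentiable (by simp)
  have hcf : Continuous (fderiv ℝ h) := hsm.continuous_fderiv (by simp)
  have key : (fun c : ℝ => fderiv ℝ h (c • x) u) = fun c : ℝ => c ^ k * fderiv ℝ h x u := by
    refine Continuous.ext_on (dense_compl_singleton (0:ℝ)) (by fun_prop) (by fun_prop) ?_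
    intro c hc
    have hc' : c ≠ 0 := hc
    have h1 : HasFDerivAt (fun x => h (c • x))
        ((fderiv ℝ h (c • x)).comp (c • ContinuousLinearMap.id ℝ _)) x :=
      (hd (c • x)).hasFDerivAt.comp x ((hasFDerivAt_id x).const_smul c)
    have h2 : HasFDerivAt (fun x => h (c • x)) (c ^ (k+1) • fderiv ℝ h x) x := by
      simp only [hhom]
      exact (hd x).hasFDerivAt.const_mul _
    have h3 := congrArg (fun L : EuclideanSpace ℝ (Fin n) →L[ℝ] ℝ => L u) (h1.unique h2)
    simp [pow_succ] at h3
    have h4 : c * fderiv ℝ h (c • x) u = c * (c ^ k * fderiv ℝ h x u) := by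
      rw [h3]; ring
    exact mul_left_cancel₀ hc' h4
  exact congrFun key c

lemma euler {k : ℕ} {h : EuclideanSpace ℝ (Fin n) → ℝ} (hsm : ContDiff ℝ (⊤ : ℕ∞) h)
    (hhom : ∀ (c : ℝ) x, h (c • x) = c ^ k * h x) (x : EuclideanSpace ℝ (Fin n)) :
    fderiv ℝ h x x = k * h x := by
  have hd : Differentiable ℝ h := hsm.differentiable (by simp)
  have h1 : HasDerivAt (fun c : ℝ => h (c • x)) (fderiv ℝ h ((1:ℝ) • x) ((1:ℝ) • x)) 1 :=
    (hd _).hasFDerivAt.comp_hasDerivAt (1:ℝ) ((hasDerivAt_id (1:ℝ)).smul_const x)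
  have h2 : HasDerivAt (fun c : ℝ => h (c • x)) ((k:ℝ) * h x) 1 := by
    simp only [hhom]
    simpa using (hasDerivAt_pow k (1:ℝ)).mul_const (h x)
  simpa using h1.unique h2

lemma main_ind {d : ℝ} (hn : 2 < n)
    (hfin : μH[d] (Metric.sphere (0 : EuclideanSpace ℝ (Fin n)) 1) ≠ ⊤)
    (u : EuclideanSpace ℝ (Fin n)) (k : ℕ) :
    ∀ (h : EuclideanSpace ℝ (Fin n) → ℝ)
    (_ : ContDiff ℝ (⊤ : ℕ∞) h)
    (_ : ∀ x, ∑ j : Fin n,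
      fderiv ℝ (fun y => fderiv ℝ h y (EuclideanSpace.single j 1)) x
        (EuclideanSpace.single j 1) = 0)
    (_ : ∀ (c : ℝ) x, h (c • x) = c ^ k * h x),
    ∫ x in Metric.sphere (0 : EuclideanSpace ℝ (Fin n)) 1, h (u - (2 * ⟪x, u⟫) • x) ∂μH[d]
      = (((n : ℝ) - 2) / ((n : ℝ) - 2 + 2 * k)) * h u *
        (μH[d] (Metric.sphere (0 : EuclideanSpace ℝ (Fin n)) 1)).toReal := by
  have hn' : (0:ℝ) < (n:ℝ) - 2 := by
    have : (2:ℝ) < n := by exact_mod_cast hn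
    linarith
  induction k with
  | zero =>
    intro h hsm hharm hhom
    have hc : ∀ x, h x = h u := by
      intro x
      have h1 := hhom 0 x
      have h2 := hhom 0 u
      simp at h1 h2
      rw [← h1, ← h2]
    simp only [hc]
    simp [Measure.real, hn'.ne', mul_comm]
  | succ k ih =>
    intro h hsm hharm hhom
    have hI := ih _ (fd_smooth hsm u) (fd_harm hsm hharm u) (fd_hom hsm hhom u)
    have hcf : Continuous (fderiv ℝ h) := hsm.continuous_fderiv (by simp)
    have hE := euler hsm hhom
    have hH : ∀ y w, fderiv ℝ (fderiv ℝ h) y y w = k * fderiv ℝ h y w := by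
      intro y w
      rw [← fd_apply hsm]
      exact euler (fd_smooth hsm w) (fd_hom hsm hhom w) y
    rw [hE u] at hI
    set S := Metric.sphere (0 : EuclideanSpace ℝ (Fin n)) 1 with hS
    set y : EuclideanSpace ℝ (Fin n) → EuclideanSpace ℝ (Fin n) :=
      fun x => u - (2 * ⟪x, u⟫) • x with hy
    have hyc : Continuous y := by rw [hy]; fun_prop
    have hys : ContDiff ℝ 1 y :=
      contDiff_const.sub ((contDiff_const.mul (contDiff_id.inner ℝ contDiff_const)).smul contDiff_id)
    have hyd : ∀ x v, fderiv ℝ y x v = -((2 * ⟪v, u⟫) • x + (2 * ⟪x, u⟫) • v) := by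
      intro x v
      have h1 : HasFDerivAt (fun x : EuclideanSpace ℝ (Fin n) => 2 * ⟪x, u⟫)
          ((2:ℝ) • innerSL ℝ u) x := by
        have := ((innerSL ℝ u).hasFDerivAt (x := x)).const_mul (2:ℝ)
        refine this.congr_of_eventuallyEq (Filter.Eventually.of_forall fun z => ?_)
        simp [real_inner_comm]
      have h2 := ((h1.smul (hasFDerivAt_id x)).const_sub u).fderiv
      have h3 : fderiv ℝ y x = _ := h2
      rw [h3]
      simp [real_inner_comm, add_comm]
    let g : Fin n → EuclideanSpace ℝ (Fin n) → ℝ :=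
      fun b x => ⟪x, u⟫ * fderiv ℝ h (y x) (EuclideanSpace.single b 1)
    have hg : ∀ b, ContDiff ℝ 1 (g b) := by
      intro b
      have h1 : ContDiff ℝ 1 (fun z => fderiv ℝ h z (EuclideanSpace.single b 1)) :=
        (fd_smooth hsm _).of_le (by exact_mod_cast le_top)
      have h2 : ContDiff ℝ 1 (fun x : EuclideanSpace ℝ (Fin n) => ⟪x, u⟫) :=
        contDiff_id.inner ℝ contDiff_const
      exact h2.mul (h1.comp hys)
    have hgd : ∀ b x v, fderiv ℝ (g b) x v = ⟪v, u⟫ * fderiv ℝ h (y x) (EuclideanSpace.single b 1)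
        + ⟪x, u⟫ * fderiv ℝ (fderiv ℝ h) (y x) (fderiv ℝ y x v) (EuclideanSpace.single b 1) := by
      intro b x v
      have h1 : HasFDerivAt (fun x : EuclideanSpace ℝ (Fin n) => ⟪x, u⟫) (innerSL ℝ u) x := by
        have := ((innerSL ℝ u).hasFDerivAt (x := x))
        refine this.congr_of_eventuallyEq (Filter.Eventually.of_forall fun z => ?_)
        simp [real_inner_comm]
      have h2 : HasFDerivAt (fun x => fderiv ℝ h (y x) (EuclideanSpace.single b 1)) _ x :=
        ((fd_smooth hsm (EuclideanSpace.single b (1:ℝ))).differentiable (by simp)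
          (y x)).hasFDerivAt.comp x
          (hys.differentiable (by norm_num) x).hasFDerivAt
      have h3 : fderiv ℝ (g b) x = _ := (h1.mul h2).fderiv
      rw [h3]
      simp [fd_apply hsm, real_inner_comm]
      ring
    have hdiv := integral_div hfin hg
    have hxs : ∀ (L : EuclideanSpace ℝ (Fin n) →L[ℝ] ℝ) (x : EuclideanSpace ℝ (Fin n)),
        ∑ a, x a * L (EuclideanSpace.single a 1) = L x := by
      intro L x
      have := (EuclideanSpace.basisFun (Fin n) ℝ).sum_repr x
      conv_rhs => rw [← this]
      simp
    have hpt : ∀ x, (∑ b, fderiv ℝ (g b) x (EuclideanSpace.single b 1)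
        - ∑ b, x b * fderiv ℝ (g b) x x - ((n:ℝ) - 1) * ∑ b, x b * g b x)
        = fderiv ℝ h (y x) u - (n + 2 * k) * (⟪x, u⟫ * fderiv ℝ h (y x) x) := by
      intro x
      have e3 : ∑ b, x b * g b x = ⟪x, u⟫ * fderiv ℝ h (y x) x := by
        rw [← hxs (fderiv ℝ h (y x)) x, Finset.mul_sum]
        exact Finset.sum_congr rfl fun b _ => by simp only [g]; ring
      have e2 : ∑ b, x b * fderiv ℝ (g b) x x = ⟪x, u⟫ * fderiv ℝ h (y x) x
          - 4 * ⟪x, u⟫ ^ 2 * fderiv ℝ (fderiv ℝ h) (y x) x x := by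
        rw [← hxs (fderiv ℝ h (y x)) x, ← hxs (fderiv ℝ (fderiv ℝ h) (y x) x) x,
          Finset.mul_sum, Finset.mul_sum, ← Finset.sum_sub_distrib]
        refine Finset.sum_congr rfl fun b _ => ?_
        rw [hgd, hyd]
        simp
        ring
      have e1 : ∑ b, fderiv ℝ (g b) x (EuclideanSpace.single b 1) = fderiv ℝ h (y x) u
          - 2 * ⟪x, u⟫ * fderiv ℝ (fderiv ℝ h) (y x) x u := by
        have hh := hharm (y x)
        simp only [fd_apply hsm] at hh
        have : fderiv ℝ h (y x) u - 2 * ⟪x, u⟫ * fderiv ℝ (fderiv ℝ h) (y x) x u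
            = fderiv ℝ h (y x) u - 2 * ⟪x, u⟫ * fderiv ℝ (fderiv ℝ h) (y x) x u
             - 2 * ⟪x, u⟫ ^ 2 * ∑ j : Fin n, fderiv ℝ (fderiv ℝ h) (y x)
              (EuclideanSpace.single j 1) (EuclideanSpace.single j 1) := by rw [hh]; ring
        rw [this, ← hxs (fderiv ℝ h (y x)) u, ← hxs (fderiv ℝ (fderiv ℝ h) (y x) x) u,
          Finset.mul_sum, Finset.mul_sum, ← Finset.sum_sub_distrib, ← Finset.sum_sub_distrib]
        refine Finset.sum_congr rfl fun b _ => ?_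
        rw [hgd, hyd]
        simp [EuclideanSpace.inner_single_left]
        ring
      have e4 := hH (y x) x
      have e5 : fderiv ℝ (fderiv ℝ h) (y x) (y x) x = fderiv ℝ (fderiv ℝ h) (y x) x u
          - 2 * ⟪x, u⟫ * fderiv ℝ (fderiv ℝ h) (y x) x x := by
        rw [fd_symm hsm u x]
        conv_lhs => rw [show fderiv ℝ (fderiv ℝ h) (y x) (y x) x
          = fderiv ℝ (fderiv ℝ h) (y x) (u - (2 * ⟪x, u⟫) • x) x from rfl]
        simp
      rw [e5] at e4
      rw [e1, e2, e3]
      linear_combination (-2 * ⟪x, u⟫) * e4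
    simp only [hpt] at hdiv
    have hc1 : Continuous (fun x => fderiv ℝ h (y x) u) := by fun_prop
    have hc2 : Continuous (fun x : EuclideanSpace ℝ (Fin n) => ⟪x, u⟫ * fderiv ℝ h (y x) x) := by
      fun_prop
    have hi1 := integrable_sphere hfin hc1
    have hi2 := integrable_sphere hfin hc2
    rw [integral_sub hi1 (hi2.const_mul _), integral_const_mul, hI] at hdiv
    have hF : ((k:ℝ) + 1) * ∫ x in S, h (y x) ∂μH[d] =
        (∫ x in S, fderiv ℝ h (y x) u ∂μH[d])
          - 2 * ∫ x in S, ⟪x, u⟫ * fderiv ℝ h (y x) x ∂μH[d] := by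
      rw [← integral_const_mul, ← integral_const_mul, ← integral_sub hi1 (hi2.const_mul _)]
      refine integral_congr_ae (Filter.Eventually.of_forall fun x => ?_)
      have e := hE (y x)
      have e5 : fderiv ℝ h (y x) (y x) = fderiv ℝ h (y x) u
          - 2 * ⟪x, u⟫ * fderiv ℝ h (y x) x := by
        conv_lhs => rw [show fderiv ℝ h (y x) (y x)
          = fderiv ℝ h (y x) (u - (2 * ⟪x, u⟫) • x) from rfl]
        simp
      rw [e5] at e
      push_cast at e
      simp only
      linear_combination -e
    rw [hI] at hF
    generalize (∫ x in S, ⟪x, u⟫ * fderiv ℝ h (y x) x ∂μH[d]) = J at *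
    generalize (∫ x in S, h (y x) ∂μH[d]) = F at *
    generalize (μH[d] S).toReal = w at *
    have hk0 : (0:ℝ) ≤ k := Nat.cast_nonneg k
    push_cast at *
    have hA : (n:ℝ) - 2 + 2 * k ≠ 0 := by positivity
    have hB : (n:ℝ) - 2 + 2 * (k + 1) ≠ 0 := by positivity
    have hB' : (n:ℝ) + 2 * k ≠ 0 := by intro h0; apply hB; linarith
    have hC : (k:ℝ) + 1 ≠ 0 := by positivity
    have hJ : J = ((n:ℝ) - 2) / (n - 2 + 2 * k) * ((k + 1) * h u) * w / (n + 2 * k) := by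
      field_simp
      field_simp at hdiv
      linarith
    rw [hJ] at hF
    apply mul_left_cancel₀ hC
    rw [hF, show (n:ℝ) - 2 + 2 * (k + 1) = n + 2 * k by ring]
    field_simp
    ring

end Harm

/-- Mean value of reflected harmonics: for `n > 2` and `h` a harmonic polynomial on `ℝⁿ`
homogeneous of degree `k`, for every unit vector `u`,
`(1/ω_n) ∫_{S^{n-1}} h(u - 2⟨x,u⟩x) dS(x) = ((n-2)/(n-2+2k)) h(u)`. -/
theorem stmt11 (n k : ℕ) (hn : 2 < n) (h : EuclideanSpace ℝ (Fin n) → ℝ)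
    (hsm : ContDiff ℝ (⊤ : ℕ∞) h)
    (hharm : ∀ x, ∑ j : Fin n,
      fderiv ℝ (fun y => fderiv ℝ h y (EuclideanSpace.single j 1)) x
        (EuclideanSpace.single j 1) = 0)
    (hhom : ∀ (c : ℝ) x, h (c • x) = c ^ k * h x)
    (u : EuclideanSpace ℝ (Fin n)) (hu : ‖u‖ = 1) :
    (omegaN n)⁻¹ *
        ∫ x in Metric.sphere (0 : EuclideanSpace ℝ (Fin n)) 1,
          h (u - (2 * ⟪x, u⟫) • x) ∂(μH[((n : ℝ) - 1)])
      = (((n : ℝ) - 2) / ((n : ℝ) - 2 + 2 * k)) * h u := by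
  have hfin : μH[((n : ℝ) - 1)] (Metric.sphere (0 : EuclideanSpace ℝ (Fin n)) 1) ≠ ⊤ := by
    obtain ⟨m, rfl⟩ : ∃ m, n = m + 1 := ⟨n - 1, by omega⟩
    have := sphere_finite m
    simpa using this
  have hpos : μH[((n : ℝ) - 1)] (Metric.sphere (0 : EuclideanSpace ℝ (Fin n)) 1) ≠ 0 := by
    obtain ⟨m, rfl⟩ : ∃ m, n = m + 1 := ⟨n - 1, by omega⟩
    have := sphere_nonempty_pos m
    simpa using this
  rw [main_ind hn hfin u k h hsm hharm hhom, omegaN]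
  have hw := ENNReal.toReal_ne_zero.2 ⟨hpos, hfin⟩
  field_simp
end
end

section
/- For λ > 0 and the normalized Gegenbauer polynomial P_k^λ(t) = Σ_{i=0}^k ((-k)_i (k+2λ)_i)/((λ+1/2)_i i!) ((1-t)/2)^i, one has ∫_{-1}^{1} P_k^λ(1 - 2t²)(1 - t²)^{λ - 1/2} dt = (Γ(1/2)Γ(λ+1/2)/Γ(λ+1)) · λ/(λ+k). -/
open scoped Nat
noncomputable section

/-- The normalized Gegenbauer polynomial
`P_k^λ(t) = Σ_{i=0}^k ((-k)_i (k+2λ)_i)/((λ+1/2)_i i!) ((1-t)/2)^i`,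
where `(a)_i` is the Pochhammer symbol (rising factorial). -/
def gegen (k : ℕ) (l : ℝ) (t : ℝ) : ℝ :=
  ∑ i ∈ Finset.range (k + 1),
    ((ascPochhammer ℝ i).eval (-(k : ℝ)) * (ascPochhammer ℝ i).eval ((k : ℝ) + 2 * l)) /
        ((ascPochhammer ℝ i).eval (l + 1 / 2) * (i ! : ℝ)) * ((1 - t) / 2) ^ i

lemma gg_real_beta (a b : ℝ) (ha : 0 < a) (hb : 0 < b) :
    ∫ x in Set.Ioo (0:ℝ) 1, x ^ (a - 1) * (1 - x) ^ (b - 1)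
      = Real.Gamma a * Real.Gamma b / Real.Gamma (a + b) := by
  have h := ProbabilityTheory.beta_eq_betaIntegralReal a b ha hb
  rw [ProbabilityTheory.beta] at h
  rw [h, Complex.betaIntegral, intervalIntegral.integral_of_le zero_le_one,
    MeasureTheory.integral_Ioc_eq_integral_Ioo]
  rw [MeasureTheory.setIntegral_congr_fun (g := fun x : ℝ =>
    ((x ^ (a - 1) * (1 - x) ^ (b - 1) : ℝ) : ℂ)) measurableSet_Ioo]
  · rw [integral_complex_ofReal, Complex.ofReal_re]
  · intro x hx
    simp only
    rw [Complex.ofReal_mul, Complex.ofReal_cpow hx.1.le, Complex.ofReal_cpow (by linarith [hx.2])]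
    push_cast
    rfl

lemma gg_image : (fun x : ℝ => x ^ 2) '' Set.Ioo 0 1 = Set.Ioo 0 1 := by
  ext y
  constructor
  · rintro ⟨x, ⟨h0, h1⟩, rfl⟩
    exact ⟨by positivity, by simp only; nlinarith⟩
  · rintro ⟨h0, h1⟩
    refine ⟨√y, ⟨Real.sqrt_pos.2 h0, ?_⟩, Real.sq_sqrt h0.le⟩
    rw [Real.sqrt_lt' one_pos]; simpa using h1

lemma gg_half (i : ℕ) (l : ℝ) (hl : 0 < l) :
    ∫ t in (0 : ℝ)..1, (t ^ 2) ^ i * (1 - t ^ 2) ^ (l - 1 / 2)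
      = Real.Gamma (i + 1 / 2) * Real.Gamma (l + 1 / 2) / Real.Gamma (l + 1 + i) / 2 := by
  have h := gg_real_beta (i + 1/2) (l + 1/2) (by positivity) (by positivity)
  have h2 := MeasureTheory.integral_image_eq_integral_abs_deriv_smul (f := fun x : ℝ => x ^ 2)
    (f' := fun x => 2 * x) (s := Set.Ioo (0:ℝ) 1) measurableSet_Ioo
    (fun x _ => by simpa using (hasDerivAt_pow 2 x).hasDerivWithinAt)
    (fun x hx y hy hxy => by
      simp only at hxy
      exact (pow_left_inj₀ hx.1.le hy.1.le two_ne_zero).1 hxy)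
    (fun x : ℝ => x ^ ((i + 1/2 : ℝ) - 1) * (1 - x) ^ ((l + 1/2) - 1))
  rw [gg_image, h] at h2
  rw [show l + 1 + (i:ℝ) = (i + 1/2) + (l + 1/2) by ring, h2,
    intervalIntegral.integral_of_le zero_le_one, MeasureTheory.integral_Ioc_eq_integral_Ioo,
    ← MeasureTheory.integral_div]
  refine MeasureTheory.setIntegral_congr_fun measurableSet_Ioo ?_
  intro x hx
  have hx0 := hx.1
  simp only [smul_eq_mul]
  rw [abs_of_pos (by positivity), show (i + 1/2 - 1 : ℝ) = i - 1/2 by ring,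
    show (l + 1/2 - 1 : ℝ) = l - 1/2 by ring, Real.rpow_sub (show 0 < x ^ 2 by positivity), Real.rpow_natCast,
    ← Real.sqrt_eq_rpow, Real.sqrt_sq hx0.le]
  field_simp

lemma gg_int (i : ℕ) (l : ℝ) (hl : 0 < l) :
    IntervalIntegrable (fun t : ℝ => (t ^ 2) ^ i * (1 - t ^ 2) ^ (l - 1 / 2))
      MeasureTheory.volume 0 1 := by
  apply intervalIntegral.intervalIntegrable_of_integral_ne_zero
  rw [gg_half i l hl]
  have h1 := Real.Gamma_pos_of_pos (show (0:ℝ) < i + 1/2 by positivity)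
  have h2 := Real.Gamma_pos_of_pos (show (0:ℝ) < l + 1/2 by positivity)
  have h3 := Real.Gamma_pos_of_pos (show (0:ℝ) < l + 1 + i by positivity)
  positivity

lemma gg_int' (i : ℕ) (l : ℝ) (hl : 0 < l) :
    IntervalIntegrable (fun t : ℝ => (t ^ 2) ^ i * (1 - t ^ 2) ^ (l - 1 / 2))
      MeasureTheory.volume (-1) 0 := by
  rw [IntervalIntegrable.iff_comp_neg]
  simpa using (gg_int i l hl).symm

lemma gg_Gamma (a : ℝ) (ha : 0 < a) (i : ℕ) :
    Real.Gamma (a + i) = (ascPochhammer ℝ i).eval a * Real.Gamma a := by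
  induction i with
  | zero => simp
  | succ n ih =>
    rw [ascPochhammer_succ_eval, Nat.cast_succ, ← add_assoc, Real.Gamma_add_one (by positivity), ih]
    ring

lemma gg_full (i : ℕ) (l : ℝ) (hl : 0 < l) :
    ∫ t in (-1 : ℝ)..1, (t ^ 2) ^ i * (1 - t ^ 2) ^ (l - 1 / 2)
      = Real.Gamma (1 / 2) * Real.Gamma (l + 1 / 2) / Real.Gamma (l + 1) *
        ((ascPochhammer ℝ i).eval (1 / 2) / (ascPochhammer ℝ i).eval (l + 1)) := by
  rw [← intervalIntegral.integral_add_adjacent_intervals (gg_int' i l hl) (gg_int i l hl)]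
  have h : ∫ t in (-1 : ℝ)..0, (t ^ 2) ^ i * (1 - t ^ 2) ^ (l - 1 / 2)
      = ∫ t in (0 : ℝ)..1, (t ^ 2) ^ i * (1 - t ^ 2) ^ (l - 1 / 2) := by
    have := intervalIntegral.integral_comp_neg (a := -1) (b := 0)
      (fun t : ℝ => (t ^ 2) ^ i * (1 - t ^ 2) ^ (l - 1 / 2))
    simpa using this
  rw [h, gg_half i l hl, gg_Gamma _ (by positivity), add_comm (i:ℝ), gg_Gamma _ (by positivity)]
  have h3 := Real.Gamma_pos_of_pos (show (0:ℝ) < l + 1 by positivity)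
  have h4 := ascPochhammer_pos i (l + 1) (by positivity)
  field_simp
  ring

lemma gg_left (n : ℕ) (a : ℝ) :
    (ascPochhammer ℝ (n + 1)).eval a = a * (ascPochhammer ℝ n).eval (a + 1) := by
  simp [ascPochhammer_succ_left]

/-- summand -/
def ggT (l : ℝ) (k i : ℕ) : ℝ :=
  ((ascPochhammer ℝ i).eval (-(k : ℝ)) * (ascPochhammer ℝ i).eval ((k : ℝ) + 2 * l)) /
        ((ascPochhammer ℝ i).eval (l + 1 / 2) * (i ! : ℝ)) *
      ((ascPochhammer ℝ i).eval (1 / 2) / (ascPochhammer ℝ i).eval (l + 1))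

lemma gg_tele (l : ℝ) (hl : 0 < l) (k n : ℕ) :
    ∑ i ∈ Finset.range (n + 1), ((l + k + 1) * ggT l (k + 1) i - (l + k) * ggT l k i)
      = 2 * ((ascPochhammer ℝ n).eval (-(k : ℝ)) * (ascPochhammer ℝ n).eval (k + 2 * l + 1)
        * (ascPochhammer ℝ (n + 1)).eval (1 / 2)) / ((ascPochhammer ℝ n).eval (l + 1 / 2) *
          (n ! : ℝ) * (ascPochhammer ℝ n).eval (l + 1)) := by
  induction n with
  | zero => simp [ggT]
  | succ n ih =>
    rw [Finset.sum_range_succ, ih, ggT, ggT]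
    rw [gg_left n (-((k + 1 : ℕ) : ℝ)), gg_left n ((k : ℝ) + 2 * l),
      show -((k + 1 : ℕ) : ℝ) + 1 = -(k : ℝ) by push_cast; ring,
      show ((k + 1 : ℕ) : ℝ) + 2 * l = k + 2 * l + 1 by push_cast; ring]
    simp only [ascPochhammer_succ_eval, Nat.factorial_succ]
    have h3 := ascPochhammer_pos n (l + 1) (by positivity)
    have h4 := ascPochhammer_pos n (l + 1 / 2) (by positivity)
    have h5 : (0 : ℝ) < n ! := by positivity
    have h6 : 0 < l + 1 / 2 + n := by positivity
    have h7 : 0 < l + 1 + n := by positivity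
    push_cast
    generalize (ascPochhammer ℝ n).eval (l + 1) = A at *
    generalize (ascPochhammer ℝ n).eval (l + 1 / 2) = B at *
    generalize (ascPochhammer ℝ n).eval (1 / 2 : ℝ) = C at *
    generalize (ascPochhammer ℝ n).eval (-(k : ℝ)) = D at *
    generalize (ascPochhammer ℝ n).eval ((k : ℝ) + 2 * l + 1) = E at *
    generalize ((n ! : ℕ) : ℝ) = F at *
    have h8 : (0 : ℝ) < n + 1 := by positivity
    field_simp
    ring

lemma gg_zero (k : ℕ) : (ascPochhammer ℝ (k + 1)).eval (-(k : ℝ)) = 0 := by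
  rw [ascPochhammer_succ_eval]; simp

lemma gg_saal (l : ℝ) (hl : 0 < l) (k : ℕ) :
    (l + k) * ∑ i ∈ Finset.range (k + 1), ggT l k i = l := by
  induction k with
  | zero => simp [ggT]
  | succ k ih =>
    have h := gg_tele l hl k (k + 1)
    rw [gg_zero, Finset.sum_sub_distrib, ← Finset.mul_sum, ← Finset.mul_sum,
      Finset.sum_range_succ (fun i => ggT l k i),
      show ggT l k (k + 1) = 0 by rw [ggT, gg_zero]; simp, add_zero, ih] at h
    push_cast
    simp only [zero_mul, mul_zero, zero_div] at h
    linarith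

/-- For `λ > 0`,
`∫_{-1}^1 P_k^λ(1-2t²)(1-t²)^{λ-1/2} dt = (Γ(1/2)Γ(λ+1/2)/Γ(λ+1)) · λ/(λ+k)`. -/
theorem stmt12 (k : ℕ) (l : ℝ) (hl : 0 < l) :
    ∫ t in (-1 : ℝ)..1, gegen k l (1 - 2 * t ^ 2) * (1 - t ^ 2) ^ (l - 1 / 2)
      = Real.Gamma (1 / 2) * Real.Gamma (l + 1 / 2) / Real.Gamma (l + 1) * (l / (l + k)) := by
  have hk : (0 : ℝ) < l + k := by positivity
  have hs : l / (l + k) = ∑ i ∈ Finset.range (k + 1), ggT l k i := by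
    rw [div_eq_iff hk.ne', mul_comm]; exact (gg_saal l hl k).symm
  simp only [gegen, Finset.sum_mul]
  rw [hs, intervalIntegral.integral_finsetSum]
  · rw [Finset.mul_sum]
    refine Finset.sum_congr rfl fun i _ => ?_
    have e : ∀ t : ℝ, (1 - (1 - 2 * t ^ 2)) / 2 = t ^ 2 := fun t => by ring
    simp only [e, mul_assoc (_ / _)]
    rw [intervalIntegral.integral_const_mul, gg_full i l hl, ggT]
    ring
  · intro i _
    have e : ∀ t : ℝ, (1 - (1 - 2 * t ^ 2)) / 2 = t ^ 2 := fun t => by ring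
    simp only [e, mul_assoc (_ / _)]
    exact ((gg_int' i l hl).trans (gg_int i l hl)).const_mul _
end
end
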